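/- There exists an absolute constant c > 0 such that the following holds. Let ε, β ∈ (0, 1/8), let n ≥ 40⁵ be an integer, let δ ≤ 1/(200·n²), let Δ < t ≤ n be integers, and let w be a real with 1 ≤ w ≤ (1/4)·tower(⌊log₂(n^{1/5}/40)⌋). Then for every finite set X ⊆ ℝ, if there exists an (ε,δ)-differentially private algorithm that solves the 1-cluster problem (X, n, t) with parameters (Δ, w) and error probability β, then n ≥ c·log*(|X|). -/

import Mathlib

open MeasureTheory
open scoped NNReal ENNReal

/-- Iterated logarithm (base 2). -/
noncomputable def logStar (x : ℝ) : ℕ := sInf {k : ℕ | (Real.logb 2)^[k] x ≤ 1}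

/-- The tower function: `tower 0 = 1` and `tower (j+1) = 2 ^ tower j`. -/
def tower : ℕ → ℕ
  | 0 => 1
  | j + 1 => 2 ^ tower j

/-- Number of entries of `S` inside the closed interval `[a, b]`. -/
noncomputable def intervalCount {n : ℕ} (S : Fin n → ℝ) (a b : ℝ) : ℕ :=
  Nat.card {i : Fin n // a ≤ S i ∧ S i ≤ b}

/-- The minimal radius of a closed interval centered at a point of `X`
containing at least `t` entries of `S`. -/
noncomputable def rOpt1 {n : ℕ} (X : Set ℝ) (S : Fin n → ℝ) (t : ℕ) : ℝ :=
  sInf {r : ℝ | 0 ≤ r ∧ ∃ c ∈ X, t ≤ intervalCount S (c - r) (c + r)}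

/-- `(ε,δ)`-differential privacy for databases whose entries all lie in `A`. -/
def IsDPOn {U Ω : Type*} [MeasurableSpace Ω] {n : ℕ} (A : Set U)
    (M : (Fin n → U) → Measure Ω) (ε δ : ℝ) : Prop :=
  ∀ S S' : Fin n → U, (∀ i, S i ∈ A) → (∀ i, S' i ∈ A) →
    (∃ i₀, S i₀ ≠ S' i₀ ∧ ∀ j, j ≠ i₀ → S j = S' j) →
    ∀ T : Set Ω, MeasurableSet T →
      M S T ≤ ENNReal.ofReal (Real.exp ε) * M S' T + ENNReal.ofReal δ

/-- `M` solves the 1-cluster problem `(X, n, t)` with parameters `(Δ, w)` and error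
probability `β`. -/
def Solves1Cluster {n : ℕ} (X : Set ℝ) (M : (Fin n → ℝ) → Measure (ℝ × ℝ≥0))
    (t : ℕ) (Δ : ℤ) (w β : ℝ) : Prop :=
  ∀ S : Fin n → ℝ, (∀ i, S i ∈ X) →
    ENNReal.ofReal (1 - β) ≤
      M S {cr : ℝ × ℝ≥0 |
        (t : ℝ) - (Δ : ℝ) ≤ (intervalCount S (cr.1 - (cr.2 : ℝ)) (cr.1 + (cr.2 : ℝ)) : ℝ) ∧
        (cr.2 : ℝ) ≤ w * rOpt1 X S t}

/-- A finitely additive probability on all subsets of `Ω`. -/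
structure IsFinAddProb {Ω : Type*} (P : Set Ω → ℝ) : Prop where
  nonneg : ∀ A, 0 ≤ P A
  univ : P Set.univ = 1
  union : ∀ A B, Disjoint A B → P (A ∪ B) = P A + P B

namespace IsFinAddProb

variable {Ω : Type*} {P : Set Ω → ℝ}

lemma mono (h : IsFinAddProb P) {A B : Set Ω} (hAB : A ⊆ B) : P A ≤ P B := by
  have := h.union A (B \ A) Set.disjoint_sdiff_right
  rw [Set.union_sdiff_cancel hAB] at this
  linarith [h.nonneg (B \ A)]

lemma le_one (h : IsFinAddProb P) (A : Set Ω) : P A ≤ 1 :=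
  h.univ ▸ h.mono (Set.subset_univ A)

lemma union_le (h : IsFinAddProb P) (A B : Set Ω) : P (A ∪ B) ≤ P A + P B := by
  have := h.union A (B \ A) Set.disjoint_sdiff_right
  rw [Set.union_sdiff_self] at this
  linarith [h.mono (Set.sdiff_subset : B \ A ⊆ B)]

lemma empty (h : IsFinAddProb P) : P ∅ = 0 := by
  have := h.union ∅ ∅ (by simp)
  simp at this
  exact this

lemma sum_fiber_le {V : Type*} (h : IsFinAddProb P) (g : Ω → V) (s : Finset V) :
    ∑ v ∈ s, P {o | g o = v} ≤ 1 := by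
  classical
  have key : ∑ v ∈ s, P {o | g o = v} = P {o | g o ∈ s} := by
    induction s using Finset.induction_on with
    | empty => simp [h.empty]
    | insert a s ha ih =>
      rw [Finset.sum_insert ha, ih, ← h.union]
      · congr 1
        ext o
        simp
      · rw [Set.disjoint_left]
        rintro o (rfl : g o = a) ho
        exact ha ho
  rw [key]
  exact h.le_one _

lemma comap {Ω' : Type*} (h : IsFinAddProb P) (f : Ω → Ω') :
    IsFinAddProb (fun T => P (f ⁻¹' T)) where
  nonneg _ := h.nonneg _
  univ := by simpa using h.univ
  union A B hAB := by
    simpa using h.union _ _ (hAB.preimage f)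

lemma average {ι : Type*} [Fintype ι] [Nonempty ι] {Q : ι → Set Ω → ℝ}
    (h : ∀ i, IsFinAddProb (Q i)) :
    IsFinAddProb (fun T => (∑ i, Q i T) / Fintype.card ι) where
  nonneg A := div_nonneg (Finset.sum_nonneg fun i _ => (h i).nonneg A) (Nat.cast_nonneg _)
  univ := by
    simp [(h _).univ]
  union A B hAB := by
    simp only [(h _).union A B hAB, Finset.sum_add_distrib, add_div]

end IsFinAddProb

/-- There is an `(ε,δ)`-differentially private mechanism on `k`-entry databases over `D` which
finds an interior point with error probability at most `β`. -/
def HasInteriorPoint (D : Type*) [LinearOrder D] (k : ℕ) (ε δ β : ℝ) : Prop :=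
  ∃ P : (Fin k → D) → Set D → ℝ, (∀ S, IsFinAddProb (P S)) ∧
    (∀ S i x T, P S T ≤ Real.exp ε * P (Function.update S i x) T + δ) ∧
    ∀ S, 1 - β ≤ P S {o | ∃ i j, S i ≤ o ∧ o ≤ S j}

lemma exists_rounding {D E : Type*} [LinearOrder D] [LinearOrder E] [Fintype D] [Nonempty D]
    (e : D ↪o E) : ∃ r : E → D, ∀ o a b, e a ≤ o → o ≤ e b → a ≤ r o ∧ r o ≤ b := by
  classical
  have : ∀ o, ∃ u, ∀ a b, e a ≤ o → o ≤ e b → a ≤ u ∧ u ≤ b := by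
    intro o
    by_cases h : (Finset.univ.filter fun u => e u ≤ o).Nonempty
    · refine ⟨Finset.max' _ h, fun a b ha hb =>
        ⟨Finset.le_max' _ a (by simpa using ha), ?_⟩⟩
      · have hm := Finset.max'_mem _ h
        rw [Finset.mem_filter] at hm
        exact e.le_iff_le.1 (hm.2.trans hb)
    · refine ⟨Classical.arbitrary D, fun a b ha hb => (h ⟨a, ?_⟩).elim⟩
      simpa using ha
  choose r hr using this
  exact ⟨r, hr⟩

lemma HasInteriorPoint.of_orderEmbedding {D E : Type*} [LinearOrder D] [LinearOrder E]
    [Fintype D] [Nonempty D] (e : D ↪o E) {k : ℕ} {ε δ β : ℝ}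
    (h : HasInteriorPoint E k ε δ β) : HasInteriorPoint D k ε δ β := by
  obtain ⟨P, hP, hdp, hs⟩ := h
  obtain ⟨r, hr⟩ := exists_rounding e
  refine ⟨fun S T => P (e ∘ S) (r ⁻¹' T), fun S => (hP _).comap r, fun S i x T => ?_, fun S => ?_⟩
  · simp only [Function.comp_update]
    exact hdp _ _ _ _
  · refine (hs (e ∘ S)).trans ((hP _).mono ?_)
    rintro o ⟨i, j, hi, hj⟩
    exact ⟨i, j, hr o _ _ hi hj⟩

lemma lex_le_apply {s b : ℕ} {o c : Lex (Fin s → Fin b)} {p : Fin s}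
    (hagree : ∀ q < p, o q = c q) (h : o ≤ c) : o p ≤ c p := by
  by_contra! hlt
  exact absurd h (not_le.2 ⟨p, fun q hq => (hagree q hq).symm, hlt⟩)

lemma lex_agree_of_between {s b : ℕ} {y a o c : Lex (Fin s → Fin b)} {m : Fin s}
    (ha : ∀ q < m, a q = y q) (hc : ∀ q < m, c q = y q) (hao : a ≤ o) (hoc : o ≤ c) :
    ∀ q < m, o q = y q := by
  intro q
  induction q using WellFoundedLT.induction with
  | _ q ih =>
    intro hq
    apply le_antisymm
    · rw [← hc q hq]
      exact lex_le_apply (fun p hp => by rw [ih p hp (hp.trans hq), hc p (hp.trans hq)]) hoc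
    · rw [← ha q hq]
      exact lex_le_apply (fun p hp => by rw [ih p hp (hp.trans hq), ha p (hp.trans hq)]) hao

lemma exists_first_difference {s b : ℕ} (hs : 0 < s) :
    ∃ L : Lex (Fin s → Fin b) → Lex (Fin s → Fin b) → Fin s, ∀ y o,
      (∀ m, (∀ q < m, o q = y q) → o ≠ y → m ≤ L y o) ∧ (∀ x, o x ≠ y x → L y o ≤ x) := by
  classical
  have : ∀ y o : Lex (Fin s → Fin b), ∃ l : Fin s,
      (∀ m, (∀ q < m, o q = y q) → o ≠ y → m ≤ l) ∧ (∀ x, o x ≠ y x → l ≤ x) := by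
    intro y o
    by_cases h : (Finset.univ.filter fun x => o x ≠ y x).Nonempty
    · refine ⟨Finset.min' _ h, fun m hm _ => ?_, fun x hx => Finset.min'_le _ _ (by simpa using hx)⟩
      have hmem := Finset.min'_mem _ h
      rw [Finset.mem_filter] at hmem
      by_contra! hlt
      exact hmem.2 (hm _ hlt)
    · have hall : ∀ x, o x = y x := fun x => by
        by_contra hx
        exact h ⟨x, by simpa using hx⟩
      exact ⟨⟨0, hs⟩, fun m _ hne => (hne (funext hall)).elim, fun x hx => (hx (hall x)).elim⟩
  choose L hL using this
  exact ⟨L, hL⟩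

lemma sum_apply_coordinate {s b : ℕ} (x : Fin s)
    (g : (Fin s → Fin b) → Fin b → ℝ) (hg : ∀ y u v, g (Function.update y x u) v = g y v) :
    ∑ y, ∑ v, g y v = b * ∑ y, g y (y x) := by
  let φ : (Fin s → Fin b) × Fin b → (Fin s → Fin b) × Fin b :=
    fun p => (Function.update p.1 x p.2, p.1 x)
  have hφ : Function.Involutive φ := fun p => by simp [φ]
  calc ∑ y, ∑ v, g y v = ∑ p : (Fin s → Fin b) × Fin b, g p.1 p.2 :=
        (Fintype.sum_prod_type' g).symm
    _ = ∑ p : (Fin s → Fin b) × Fin b, g (φ p).1 (φ p).2 :=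
        (Equiv.sum_comp (hφ.toPerm φ) (fun p => g p.1 p.2)).symm
    _ = ∑ p : (Fin s → Fin b) × Fin b, g p.1 (p.1 x) := by simp only [φ, hg]
    _ = ∑ y, ∑ _v : Fin b, g y (y x) :=
        Fintype.sum_prod_type' (fun (y : Fin s → Fin b) (_ : Fin b) => g y (y x))
    _ = b * ∑ y, g y (y x) := by simp [Finset.mul_sum]

/-- The word agreeing with `y` before position `x` and equal to zero from there on. -/
def truncateAt {s b : ℕ} [NeZero b] (y : Lex (Fin s → Fin b)) (x : Fin s) :
    Lex (Fin s → Fin b) :=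
  toLex fun q => if q < x then y q else 0

lemma truncateAt_update {s b : ℕ} [NeZero b] (y : Fin s → Fin b) {x x' : Fin s} (h : x ≤ x')
    (u : Fin b) : truncateAt (toLex (Function.update y x' u)) x = truncateAt (toLex y) x := by
  funext q
  change (if q < x then Function.update y x' u q else 0) = if q < x then y q else 0
  split_ifs with hq
  · rw [Function.update_of_ne (hq.trans_le h).ne]
  · rfl

lemma HasInteriorPoint.descend {s b k : ℕ} (hs : 0 < s) [NeZero b] {ε δ β : ℝ}
    (h : HasInteriorPoint (Lex (Fin s → Fin b)) (k + 2) ε δ β) :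
    HasInteriorPoint (Fin s) (k + 1) ε δ (β + Real.exp ε / b + δ) := by
  classical
  obtain ⟨P, hP, hdp, hsucc⟩ := h
  obtain ⟨L, hL⟩ := exists_first_difference (b := b) hs
  have hb : (0 : ℝ) < b := by exact_mod_cast Nat.pos_of_ne_zero (NeZero.ne b)
  set N : ℝ := (Fintype.card (Fin s → Fin b) : ℝ) with hN
  have hNpos : 0 < N := by
    rw [hN]
    exact_mod_cast Fintype.card_pos
  let db : (Fin (k + 1) → Fin s) → (Fin s → Fin b) → Fin (k + 2) → Lex (Fin s → Fin b) :=
    fun S y => Fin.cons (toLex y) fun i => truncateAt (toLex y) (S i)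
  refine ⟨fun S T => (∑ y : Fin s → Fin b, P (db S y) (L (toLex y) ⁻¹' T)) /
    (Fintype.card (Fin s → Fin b) : ℝ),
    fun S => IsFinAddProb.average fun y => (hP _).comap _, fun S i x T => ?_, fun S => ?_⟩
  · have hdb : ∀ y, db (Function.update S i x) y =
        Function.update (db S y) i.succ (truncateAt (toLex y) x) := by
      intro y
      change (Fin.cons _ _ : Fin (k + 2) → Lex (Fin s → Fin b)) = _
      rw [← Fin.cons_update]
      congr 1
      funext j
      by_cases hj : j = i
      · subst hj
        simp
      · simp [hj]
    change _ / N ≤ Real.exp ε * (_ / N) + δ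
    rw [div_le_iff₀ hNpos, add_mul, mul_assoc, div_mul_cancel₀ _ hNpos.ne', Finset.mul_sum]
    have : δ * N = ∑ _y : Fin s → Fin b, δ := by
      rw [Finset.sum_const, nsmul_eq_mul, Finset.card_univ, mul_comm]
    rw [this, ← Finset.sum_add_distrib]
    refine Finset.sum_le_sum fun y _ => ?_
    rw [hdb]
    exact hdp _ _ _ _
  · obtain ⟨im, -, him⟩ := Finset.exists_max_image Finset.univ S Finset.univ_nonempty
    obtain ⟨i₀, -, hi₀⟩ := Finset.exists_min_image Finset.univ S Finset.univ_nonempty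
    set xs := S im with hxs
    let db' : (Fin s → Fin b) → Fin (k + 2) → Lex (Fin s → Fin b) :=
      fun y => Fin.cons (truncateAt (toLex y) xs) fun i => truncateAt (toLex y) (S i)
    have hupd : ∀ y, Function.update (db S y) 0 (truncateAt (toLex y) xs) = db' y :=
      fun y => Fin.update_cons_zero _ _ _
    let g : (Fin s → Fin b) → Fin b → ℝ := fun y v => P (db' y) {o | o xs = v}
    have hg : ∀ y u v, g (Function.update y xs u) v = g y v := by
      intro y u v
      have : db' (Function.update y xs u) = db' y := by
        simp only [db']
        rw [truncateAt_update y le_rfl]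
        congr 1
        funext i
        exact truncateAt_update y (him i (Finset.mem_univ i)) u
      simp only [g, this]
    have hguess : ∑ y, g y (y xs) ≤ N / b := by
      rw [le_div_iff₀ hb, mul_comm, ← sum_apply_coordinate xs g hg]
      calc ∑ y, ∑ v, g y v ≤ ∑ _y : Fin s → Fin b, (1 : ℝ) :=
            Finset.sum_le_sum fun y _ =>
              (hP (db' y)).sum_fiber_le (fun o : Lex (Fin s → Fin b) => o xs) Finset.univ
        _ = N := by simp [hN]
    have hy : ∀ y : Fin s → Fin b, 1 - β ≤
        P (db S y) (L (toLex y) ⁻¹' {o | ∃ i j, S i ≤ o ∧ o ≤ S j}) +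
          (Real.exp ε * g y (y xs) + δ) := by
      intro y
      have h1 := hdp (db S y) 0 (truncateAt (toLex y) xs) {o | o xs = y xs}
      rw [hupd] at h1
      refine (hsucc (db S y)).trans (le_trans ?_ (add_le_add_right h1 _))
      refine ((hP _).mono ?_).trans ((hP _).union_le _ _)
      rintro o ⟨i, j, hi, hj⟩
      by_cases ho : o xs = y xs
      · exact Or.inr ho
      · left
        have hagree : ∀ i, ∀ q < S i₀, db S y i q = (toLex y) q := by
          intro i q hq
          refine Fin.cases rfl (fun i => ?_) i
          change (if q < S i then y q else 0) = y q
          rw [if_pos (hq.trans_le (hi₀ i (Finset.mem_univ i)))]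
        refine ⟨i₀, im, (hL (toLex y) o).1 _
          (lex_agree_of_between (hagree i) (hagree j) hi hj) ?_, (hL (toLex y) o).2 _ ho⟩
        rintro rfl
        exact ho rfl
    have hsum := Finset.sum_le_sum fun y (_ : y ∈ (Finset.univ : Finset (Fin s → Fin b))) => hy y
    simp only [Finset.sum_add_distrib, Finset.sum_const, nsmul_eq_mul, ← Finset.mul_sum,
      Finset.card_univ] at hsum
    change _ ≤ _ / N
    rw [le_div_iff₀ hNpos]
    have h2 := mul_le_mul_of_nonneg_left hguess (Real.exp_pos ε).le
    rw [← hN] at hsum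
    have h3 : Real.exp ε * (N / b) = Real.exp ε / b * N := by ring
    nlinarith

lemma not_hasInteriorPoint_one {m : ℕ} (hm : 2 ≤ m) {ε δ β : ℝ} (hε : Real.exp ε ≤ 2)
    (hβ : β ≤ 1 / 4) (hδ : δ < 1 / 4) : ¬ HasInteriorPoint (Fin m) 1 ε δ β := by
  rintro ⟨P, hP, hdp, hs⟩
  obtain ⟨a, b, hab⟩ : ∃ a b : Fin m, a ≠ b :=
    ⟨⟨0, by omega⟩, ⟨1, by omega⟩, by simp⟩
  have hset : ∀ x : Fin m, {o | ∃ i j : Fin 1, (fun _ : Fin 1 => x) i ≤ o ∧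
      o ≤ (fun _ : Fin 1 => x) j} = {x} := by
    intro x
    ext o
    simp only [exists_const, Set.mem_ofPred_eq, Set.mem_singleton_iff]
    exact ⟨fun h => le_antisymm h.2 h.1, fun h => h ▸ ⟨le_rfl, le_rfl⟩⟩
  have ha := hs fun _ => a
  have hb := hs fun _ => b
  rw [hset] at ha hb
  have hu : Function.update (fun _ : Fin 1 => b) 0 a = fun _ => a := by
    funext i
    simp [Subsingleton.elim i 0]
  have hd := hdp (fun _ => b) 0 a {b}
  rw [hu] at hd
  have h1 := (hP fun _ => a).union {a} {b} (by simpa using hab)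
  have h2 := (hP fun _ => a).le_one ({a} ∪ {b})
  have h3 : P (fun _ => a) {b} ≤ 1 / 4 := by linarith
  have h4 := mul_le_mul hε h3 ((hP fun _ => a).nonneg _) (by norm_num)
  linarith

/-- Domain sizes for which the interior point problem on `k + 1` entries is infeasible. -/
def hardSize (b : ℕ) : ℕ → ℕ
  | 0 => 2
  | k + 1 => b ^ hardSize b k

lemma hardSize_pos {b : ℕ} (hb : 0 < b) (k : ℕ) : 0 < hardSize b k := by
  cases k with
  | zero => simp [hardSize]
  | succ k => exact pow_pos hb _

lemma not_hasInteriorPoint {b : ℕ} (hb : 0 < b) {ε δ : ℝ} (hε : Real.exp ε ≤ 2)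
    (hδ : δ < 1 / 4) (k : ℕ) : ∀ {m : ℕ} {β : ℝ}, hardSize b k ≤ m →
      β + k * (Real.exp ε / b + δ) ≤ 1 / 4 → ¬ HasInteriorPoint (Fin m) (k + 1) ε δ β := by
  induction k with
  | zero =>
    intro m β hm hβ
    exact not_hasInteriorPoint_one hm hε (by simpa using hβ) hδ
  | succ k ih =>
    intro m β hm hβ h
    have : NeZero b := ⟨hb.ne'⟩
    have hcard : Fintype.card (Lex (Fin (hardSize b k) → Fin b)) = hardSize b (k + 1) := by
      change Fintype.card (Fin (hardSize b k) → Fin b) = _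
      simp [hardSize]
    let e : Lex (Fin (hardSize b k) → Fin b) ↪o Fin m :=
      (monoEquivOfFin _ hcard).symm.toOrderEmbedding.trans (Fin.castLEOrderEmb hm)
    have : Nonempty (Lex (Fin (hardSize b k) → Fin b)) :=
      inferInstanceAs (Nonempty (Fin (hardSize b k) → Fin b))
    refine ih le_rfl ?_ ((h.of_orderEmbedding e).descend (hardSize_pos hb k))
    push_cast at hβ
    linarith

lemma lt_tower (k : ℕ) : k < tower k := by
  induction k with
  | zero => simp [tower]
  | succ k ih => exact lt_of_le_of_lt ih (Nat.lt_two_pow_self)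

lemma tower_mono : Monotone tower :=
  monotone_nat_of_le_succ fun _ => Nat.lt_two_pow_self.le

lemma two_pow_le_tower (k : ℕ) : 2 ^ k ≤ tower k := by
  cases k with
  | zero => simp [tower]
  | succ k => exact Nat.pow_le_pow_right two_pos (lt_tower k)

lemma mul_le_two_pow {n : ℕ} (hn : 10 ≤ n) : 32 * n ≤ 2 ^ n := by
  induction n, hn using Nat.le_induction with
  | base => norm_num
  | succ n hn ih =>
    rw [pow_succ]
    omega

lemma hardSize_le_tower {n : ℕ} (hn : 10 ≤ n) (k : ℕ) :
    2 * n * hardSize (2 ^ n) k ≤ tower (n + k) := by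
  induction k with
  | zero =>
    have := two_pow_le_tower n
    have := mul_le_two_pow hn
    simp only [hardSize, add_zero]
    omega
  | succ k ih =>
    have hpos := hardSize_pos (Nat.two_pow_pos n) k
    have h1 : 2 * n ≤ 2 ^ (n * hardSize (2 ^ n) k) := by
      calc 2 * n ≤ 2 ^ n := by linarith [mul_le_two_pow hn]
        _ ≤ _ := Nat.pow_le_pow_right two_pos (Nat.le_mul_of_pos_right n hpos)
    calc 2 * n * hardSize (2 ^ n) (k + 1)
        = 2 * n * 2 ^ (n * hardSize (2 ^ n) k) := by simp [hardSize, pow_mul]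
      _ ≤ 2 ^ (n * hardSize (2 ^ n) k) * 2 ^ (n * hardSize (2 ^ n) k) :=
          Nat.mul_le_mul_right _ h1
      _ = 2 ^ (2 * n * hardSize (2 ^ n) k) := by rw [← pow_add]; ring_nf
      _ ≤ 2 ^ tower (n + k) := Nat.pow_le_pow_right two_pos ih

lemma logStar_le_of_le_tower {j : ℕ} {x : ℝ} (hx : x ≤ tower j) : logStar x ≤ j := by
  suffices h : ∃ k ≤ j, (Real.logb 2)^[k] x ≤ 1 by
    obtain ⟨k, hk, hk'⟩ := h
    exact (Nat.sInf_le hk').trans hk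
  induction j generalizing x with
  | zero => exact ⟨0, le_rfl, by simpa [tower] using hx⟩
  | succ j ih =>
    by_cases h1 : x ≤ 1
    · exact ⟨0, Nat.zero_le _, h1⟩
    · have hlog : Real.logb 2 x ≤ tower j := by
        rw [Real.logb_le_iff_le_rpow one_lt_two (by linarith), Real.rpow_natCast]
        simpa [tower] using hx
      obtain ⟨k, hk, hk'⟩ := ih hlog
      exact ⟨k + 1, by omega, hk'⟩

/-- Every gap of `Y` is more than `W` times the diameter of the part of `Y` to its right. -/
def Lacunary (W : ℝ) (Y : Finset ℝ) : Prop :=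
  ∀ x ∈ Y, ∀ y ∈ Y, ∀ z ∈ Y, x < y → y ≤ z → W * (z - y) < y - x

lemma Lacunary.insert {W p : ℝ} {Y : Finset ℝ} (h : Lacunary W Y) (hp : ∀ y ∈ Y, p < y)
    (hW : ∀ y ∈ Y, ∀ z ∈ Y, W * (z - y) < y - p) : Lacunary W (insert p Y) := by
  intro x hx y hy z hz hxy hyz
  rw [Finset.mem_insert] at hx hy hz
  rcases hy with rfl | hy
  · rcases hx with rfl | hx
    · exact absurd hxy (lt_irrefl _)
    · exact absurd hxy (hp x hx).not_gt
  rcases hz with rfl | hz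
  · exact absurd hyz (hp y hy).not_ge
  rcases hx with rfl | hx
  · exact hW y hy z hz
  · exact h x hx y hy z hz hxy hyz

lemma exists_small_far_piece {W : ℝ} (hW : 0 ≤ W) {K : ℕ} (hK : 2 * W + 4 ≤ K) {m : ℕ}
    {X : Finset ℝ} (hX : K ^ (m + 1) ≤ X.card) :
    ∃ Z ⊆ X, K ^ m ≤ Z.card ∧
      ((∃ p ∈ X, ∀ y ∈ Z, p < y ∧ ∀ z ∈ Z, W * |z - y| < y - p) ∨
       (∃ p ∈ X, ∀ y ∈ Z, y < p ∧ ∀ z ∈ Z, W * |z - y| < p - y)) := by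
  classical
  have hK4 : 4 ≤ K := by
    have : (4 : ℝ) ≤ K := by linarith
    exact_mod_cast this
  have hcard : 1 < X.card := by
    calc 1 < K := by omega
      _ = K ^ 1 := (pow_one K).symm
      _ ≤ K ^ (m + 1) := Nat.pow_le_pow_right (by omega) (by omega)
      _ ≤ X.card := hX
  have hne : X.Nonempty := Finset.card_pos.1 (by omega)
  set a := X.min' hne with ha
  set b := X.max' hne with hb
  have hab : a < b := Finset.min'_lt_max'_of_card X hcard
  set D := b - a with hD
  have hDpos : 0 < D := sub_pos.2 hab
  have hK1 : (0 : ℝ) < K - 1 := by linarith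
  let f : ℝ → ℕ := fun x => ⌊(x - a) / D * (K - 1)⌋₊
  have hf : ∀ x ∈ X, f x ∈ Finset.range K := by
    intro x hx
    have h1 : (x - a) / D ≤ 1 := by
      rw [div_le_one hDpos]
      linarith [X.le_max' x hx]
    have h0 : 0 ≤ (x - a) / D := div_nonneg (by linarith [X.min'_le x hx]) hDpos.le
    rw [Finset.mem_range]
    refine (Nat.floor_lt (by positivity)).2 ?_
    nlinarith
  obtain ⟨v, -, hv⟩ := Finset.exists_le_card_fiber_of_mul_le_card_of_maps_to hf
    ⟨0, by simp; omega⟩ (n := K ^ m) (by rw [Finset.card_range, ← pow_succ']; exact hX)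
  set Z := X.filter fun x => f x = v with hZ
  have hZX : Z ⊆ X := Finset.filter_subset _ _
  have hdiam : ∀ y ∈ Z, ∀ z ∈ Z, z - y < D / (K - 1) := by
    intro y hy z hz
    have h0 : ∀ x ∈ Z, 0 ≤ (x - a) / D * (K - 1) := fun x hx =>
      mul_nonneg (div_nonneg (by linarith [X.min'_le x (hZX hx)]) hDpos.le) hK1.le
    have hy' := Nat.floor_le (h0 y hy)
    have hz' := Nat.lt_floor_add_one ((z - a) / D * (K - 1))
    have e1 : f y = v := (Finset.mem_filter.1 hy).2
    have e2 : f z = v := (Finset.mem_filter.1 hz).2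
    simp only [f] at e1 e2
    rw [e1] at hy'
    rw [e2] at hz'
    have h3 : (z - y) / D * (K - 1) < 1 := by
      have : (z - y) / D * (K - 1) = (z - a) / D * (K - 1) - (y - a) / D * (K - 1) := by ring
      linarith
    rw [lt_div_iff₀ hK1]
    rw [div_mul_eq_mul_div, div_lt_one hDpos] at h3
    exact h3
  have hdiam' : ∀ y ∈ Z, ∀ z ∈ Z, W * |z - y| ≤ W * (D / (K - 1)) := fun y hy z hz =>
    mul_le_mul_of_nonneg_left (abs_le.2 ⟨by linarith [hdiam z hz y hy], (hdiam y hy z hz).le⟩) hW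
  have hgap : (W + 1) * (D / (K - 1)) < D / 2 := by
    rw [mul_div_assoc', div_lt_iff₀ hK1]
    nlinarith
  have hgap0 : 0 < D / (K - 1) := div_pos hDpos hK1
  have hWg : 0 ≤ W * (D / (K - 1)) := by positivity
  have hZne : Z.Nonempty := Finset.card_pos.1 ((pow_pos (by omega) m).trans_le hv)
  obtain ⟨x₀, hx₀⟩ := hZne
  refine ⟨Z, hZX, hv, ?_⟩
  rcases le_total (D / 2) (x₀ - a) with hc | hc
  · left
    refine ⟨a, X.min'_mem hne, fun y hy => ?_⟩
    have h5 := hdiam y hy x₀ hx₀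
    have h6 : W * (D / (K - 1)) < y - a := by linarith
    exact ⟨by linarith, fun z hz => (hdiam' y hy z hz).trans_lt h6⟩
  · right
    refine ⟨b, X.max'_mem hne, fun y hy => ?_⟩
    have h5 := hdiam x₀ hx₀ y hy
    have h6 : W * (D / (K - 1)) < b - y := by linarith
    exact ⟨by linarith, fun z hz => (hdiam' y hy z hz).trans_lt h6⟩

lemma exists_lacunary_pair {W : ℝ} (hW : 0 ≤ W) {K : ℕ} (hK : 2 * W + 4 ≤ K) (m : ℕ) :
    ∀ X : Finset ℝ, K ^ m ≤ X.card → ∃ L R : Finset ℝ, (∀ x ∈ L, x ∈ X) ∧ (∀ x ∈ R, -x ∈ X) ∧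
      Lacunary W L ∧ Lacunary W R ∧ m ≤ L.card + R.card := by
  classical
  induction m with
  | zero =>
    intro X _
    exact ⟨∅, ∅, by simp, by simp, by simp [Lacunary], by simp [Lacunary], by simp⟩
  | succ m ih =>
    intro X hX
    obtain ⟨Z, hZX, hZ, h⟩ := exists_small_far_piece hW hK hX
    obtain ⟨L, R, hL, hR, hL', hR', hLR⟩ := ih Z hZ
    rcases h with ⟨p, hp, hpZ⟩ | ⟨p, hp, hpZ⟩
    · refine ⟨insert p L, R, ?_, fun x hx => hZX (hR x hx), ?_, hR', ?_⟩
      · simp only [Finset.mem_insert, forall_eq_or_imp]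
        exact ⟨hp, fun x hx => hZX (hL x hx)⟩
      · refine hL'.insert (fun y hy => (hpZ y (hL y hy)).1) fun y hy z hz => ?_
        exact (mul_le_mul_of_nonneg_left (le_abs_self _) hW).trans_lt
          ((hpZ y (hL y hy)).2 z (hL z hz))
      · rw [Finset.card_insert_of_notMem fun h => lt_irrefl _ (hpZ p (hL p h)).1]
        omega
    · refine ⟨L, insert (-p) R, fun x hx => hZX (hL x hx), ?_, hL', ?_, ?_⟩
      · simp only [Finset.mem_insert, forall_eq_or_imp, neg_neg]
        exact ⟨hp, fun x hx => hZX (hR x hx)⟩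
      · refine hR'.insert (fun y hy => by linarith [(hpZ (-y) (hR y hy)).1]) fun y hy z hz => ?_
        have h1 := (hpZ (-y) (hR y hy)).2 (-z) (hR z hz)
        have h2 := mul_le_mul_of_nonneg_left (neg_le_abs (-z - -y)) hW
        have h3 : -(-z - -y) = z - y := by ring
        rw [h3] at h2
        linarith
      · rw [Finset.card_insert_of_notMem fun h => ?_]
        · omega
        · have := (hpZ _ (hR _ h)).1
          simp at this

lemma exists_lacunary_sequence {W : ℝ} (hW : 0 ≤ W) {K m : ℕ} (hK : 2 * W + 4 ≤ K)
    {X : Set ℝ} (hXf : X.Finite) (hX : K ^ (2 * m) ≤ X.ncard) :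
    ∃ σ : ℝ, (σ = 1 ∨ σ = -1) ∧ ∃ y : Fin m → ℝ, (∀ i, σ * y i ∈ X) ∧
      ∀ i j l, i < j → j ≤ l → W * (y l - y j) < y j - y i := by
  have key : ∀ Y : Finset ℝ, Lacunary W Y → m ≤ Y.card → ∃ y : Fin m → ℝ, (∀ i, y i ∈ Y) ∧
      ∀ i j l, i < j → j ≤ l → W * (y l - y j) < y j - y i := by
    intro Y hY hm
    let e : Fin m ↪o ℝ := (Fin.castLEOrderEmb hm).trans (Y.orderEmbOfFin rfl)
    have hmem : ∀ i, e i ∈ Y := fun i => Finset.orderEmbOfFin_mem Y rfl _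
    exact ⟨e, hmem, fun i j l hij hjl => hY _ (hmem i) _ (hmem j) _ (hmem l)
      (e.lt_iff_lt.2 hij) (e.le_iff_le.2 hjl)⟩
  obtain ⟨L, R, hL, hR, hL', hR', hLR⟩ := exists_lacunary_pair hW hK (2 * m) hXf.toFinset
    (by rwa [← Set.ncard_eq_toFinset_card X hXf])
  simp only [Set.Finite.mem_toFinset] at hL hR
  rcases le_total m L.card with h | h
  · obtain ⟨y, hy, hy'⟩ := key L hL' h
    exact ⟨1, Or.inl rfl, y, fun i => by simpa using hL _ (hy i), hy'⟩
  · obtain ⟨y, hy, hy'⟩ := key R hR' (by omega)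
    exact ⟨-1, Or.inr rfl, y, fun i => by simpa using hR _ (hy i), hy'⟩

lemma rOpt1_le_of_all_mem {n t : ℕ} (ht : t ≤ n) {X : Set ℝ} {S : Fin n → ℝ} {c r : ℝ}
    (hc : c ∈ X) (hr : 0 ≤ r) (h : ∀ i, |S i - c| ≤ r) : rOpt1 X S t ≤ r := by
  refine csInf_le ⟨0, fun _ hx => hx.1⟩ ⟨hr, c, hc, ?_⟩
  have : intervalCount S (c - r) (c + r) = n := by
    have hall : ∀ i, c - r ≤ S i ∧ S i ≤ c + r := fun i => by
      have := abs_le.1 (h i)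
      constructor <;> linarith
    simp [intervalCount, hall]
  omega

/-- The index of the first term of `y` that is at least `v` (the last index if there is none). -/
noncomputable def firstIndex {m : ℕ} (y : Fin (m + 1) → ℝ) (v : ℝ) : Fin (m + 1) :=
  Fin.ofNat (m + 1) (min m (∑ i, if y i < v then 1 else 0))

lemma measurable_firstIndex {m : ℕ} (y : Fin (m + 1) → ℝ) : Measurable (firstIndex y) := by
  have h : Measurable fun v : ℝ => ∑ i, if y i < v then (1 : ℕ) else 0 :=
    Finset.measurable_sum _ fun i _ =>
      Measurable.ite measurableSet_Ioi measurable_const measurable_const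
  exact (measurable_from_nat (f := fun k => Fin.ofNat (m + 1) (min m k))).comp h

lemma firstIndex_mem {m : ℕ} {y : Fin (m + 1) → ℝ} (hy : StrictMono y) {v : ℝ}
    {j l : Fin (m + 1)} (hj : ∀ i < j, y i < v) (hl : v ≤ y l) :
    j ≤ firstIndex y v ∧ firstIndex y v ≤ l := by
  have hsum : (∑ i, if y i < v then 1 else 0) = (Finset.univ.filter fun i => y i < v).card := by
    simp
  have h1 : (j : ℕ) ≤ (Finset.univ.filter fun i => y i < v).card := by
    rw [← Fin.card_Iio j]
    refine Finset.card_le_card fun i hi => ?_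
    simpa using hj i (by simpa using hi)
  have h2 : (Finset.univ.filter fun i => y i < v).card ≤ l := by
    rw [← Fin.card_Iio l]
    refine Finset.card_le_card fun i hi => ?_
    have hi' : y i < v := by simpa using hi
    simpa using hy.lt_iff_lt.1 (hi'.trans_le hl)
  have hval : (firstIndex y v : ℕ) = (Finset.univ.filter fun i => y i < v).card := by
    have hlm := l.is_lt
    simp only [firstIndex, hsum, Fin.ofNat]
    rw [Nat.mod_eq_of_lt] <;> omega
  rw [Fin.le_def, Fin.le_def, hval]
  exact ⟨h1, h2⟩

lemma firstIndex_mem_of_cluster {n m t : ℕ} {Δ : ℤ} (hΔ : Δ < t) (ht : t ≤ n) (hn : 0 < n)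
    {w : ℝ} (hw : 0 ≤ w) {X : Set ℝ} {σ : ℝ} (hσ : σ = 1 ∨ σ = -1) {y : Fin (m + 1) → ℝ}
    (hyX : ∀ i, σ * y i ∈ X)
    (hy : ∀ i j l, i < j → j ≤ l → 2 * w * (y l - y j) < y j - y i)
    (S : Fin n → Fin (m + 1)) {c r : ℝ}
    (hcount : (t : ℝ) - Δ ≤ intervalCount (fun i => σ * y (S i)) (c - r) (c + r))
    (hr : r ≤ w * rOpt1 X (fun i => σ * y (S i)) t) :
    ∃ i j, S i ≤ firstIndex y (σ * c - r) ∧ firstIndex y (σ * c - r) ≤ S j := by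
  have : Nonempty (Fin n) := ⟨⟨0, hn⟩⟩
  have hmono : StrictMono y := fun i j hij => by
    have := hy i j j hij le_rfl
    simp only [sub_self, mul_zero] at this
    linarith
  obtain ⟨jm, -, hjm⟩ := Finset.exists_max_image Finset.univ S Finset.univ_nonempty
  obtain ⟨j₀, -, hj₀⟩ := Finset.exists_min_image Finset.univ S Finset.univ_nonempty
  have hσabs : |σ| = 1 := by rcases hσ with rfl | rfl <;> simp
  have hσsq : σ * σ = 1 := by rcases hσ with rfl | rfl <;> norm_num
  have hlo : ∀ i, y (S j₀) ≤ y (S i) := fun i => hmono.monotone (hj₀ i (Finset.mem_univ i))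
  have hhi : ∀ i, y (S i) ≤ y (S jm) := fun i => hmono.monotone (hjm i (Finset.mem_univ i))
  have hopt : rOpt1 X (fun i => σ * y (S i)) t ≤ y (S jm) - y (S j₀) := by
    refine rOpt1_le_of_all_mem ht (hyX (S j₀)) (by linarith [hhi j₀]) fun i => ?_
    rw [← mul_sub, abs_mul, hσabs, one_mul, abs_of_nonneg (by linarith [hlo i])]
    linarith [hhi i]
  obtain ⟨e, he⟩ : ∃ i, c - r ≤ σ * y (S i) ∧ σ * y (S i) ≤ c + r := by
    have hpos : 0 < intervalCount (fun i => σ * y (S i)) (c - r) (c + r) := by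
      have : (Δ : ℝ) < t := by exact_mod_cast hΔ
      have : (0 : ℝ) < intervalCount (fun i => σ * y (S i)) (c - r) (c + r) := by linarith
      exact_mod_cast this
    obtain ⟨⟨i, hi⟩⟩ := (Nat.card_pos_iff.1 hpos).1
    exact ⟨i, hi⟩
  have habs : |σ * c - y (S e)| ≤ r := by
    have h1 : σ * c - y (S e) = σ * (c - σ * y (S e)) := by
      linear_combination y (S e) * hσsq
    rw [h1, abs_mul, hσabs, one_mul, abs_le]
    constructor <;> linarith
  obtain ⟨habs1, habs2⟩ := abs_le.1 habs
  have hr' : r ≤ w * (y (S jm) - y (S j₀)) := hr.trans (mul_le_mul_of_nonneg_left hopt hw)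
  refine ⟨j₀, jm, firstIndex_mem hmono (fun i hi => ?_) (by linarith [hhi e])⟩
  have := hy i (S j₀) (S jm) hi (hjm j₀ (Finset.mem_univ _))
  linarith [hlo e]

lemma hasInteriorPoint_of_cluster {n m t : ℕ} {Δ : ℤ} (hΔ : Δ < t) (ht : t ≤ n) (hn : 0 < n)
    {w ε δ β : ℝ} (hw : 0 ≤ w) (hε : 0 ≤ ε) {X : Set ℝ} {σ : ℝ} (hσ : σ = 1 ∨ σ = -1)
    {y : Fin (m + 1) → ℝ} (hyX : ∀ i, σ * y i ∈ X)
    (hy : ∀ i j l, i < j → j ≤ l → 2 * w * (y l - y j) < y j - y i)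
    {M : (Fin n → ℝ) → Measure (ℝ × ℝ≥0)} (hM : ∀ S, IsProbabilityMeasure (M S))
    (hdp : IsDPOn X M ε δ) (hsol : Solves1Cluster X M t Δ w β) :
    HasInteriorPoint (Fin (m + 1)) n ε (max δ 0) β := by
  let emb : (Fin n → Fin (m + 1)) → Fin n → ℝ := fun S i => σ * y (S i)
  let out : ℝ × ℝ≥0 → Fin (m + 1) := fun cr => firstIndex y (σ * cr.1 - cr.2)
  have hout : Measurable out := (measurable_firstIndex y).comp (by fun_prop)
  have hmeas : ∀ T : Set (Fin (m + 1)), MeasurableSet (out ⁻¹' T) := fun T =>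
    hout (MeasurableSet.of_discrete)
  refine ⟨fun S T => (M (emb S)).real (out ⁻¹' T), fun S => ⟨fun _ => measureReal_nonneg, ?_, ?_⟩,
    fun S i x T => ?_, fun S => ?_⟩
  · have := hM (emb S)
    simp
  · intro A B hAB
    have := hM (emb S)
    simp only [Set.preimage_union]
    exact measureReal_union (hAB.preimage out) (hmeas B)
  · have := hM (emb S)
    have := hM (emb (Function.update S i x))
    by_cases heq : emb S i = emb (Function.update S i x) i
    · have : emb S = emb (Function.update S i x) := by
        funext j
        by_cases hj : j = i
        · rw [hj, heq]
        · simp [emb, hj]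
      simp only [← this]
      have h1 : 1 ≤ Real.exp ε := Real.one_le_exp hε
      have h0 : 0 ≤ (M (emb S)).real (out ⁻¹' T) := measureReal_nonneg
      nlinarith [le_max_right δ 0]
    · have h := hdp (emb S) (emb (Function.update S i x)) (fun j => hyX _) (fun j => hyX _)
        ⟨i, heq, fun j hj => by simp [emb, hj]⟩ _ (hmeas T)
      have h' := ENNReal.toReal_mono
        (ENNReal.add_ne_top.2 ⟨ENNReal.mul_ne_top ENNReal.ofReal_ne_top (measure_ne_top _ _),
          ENNReal.ofReal_ne_top⟩) h
      rw [ENNReal.toReal_add (ENNReal.mul_ne_top ENNReal.ofReal_ne_top (measure_ne_top _ _))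
        ENNReal.ofReal_ne_top, ENNReal.toReal_mul, ENNReal.toReal_ofReal (Real.exp_pos ε).le,
        ENNReal.toReal_ofReal'] at h'
      exact h'
  · have := hM (emb S)
    have h := (hsol (emb S) fun i => hyX _).trans (measure_mono (t := out ⁻¹'
      {o | ∃ i j, S i ≤ o ∧ o ≤ S j}) fun cr hcr =>
        firstIndex_mem_of_cluster hΔ ht hn hw hσ hyX hy S hcr.1 hcr.2)
    exact (ENNReal.ofReal_le_iff_le_toReal (measure_ne_top _ _)).1 h

lemma tower_pow_le {n : ℕ} (hn : 10 ≤ n) :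
    tower (n + 1) ^ (2 * tower (2 * n)) ≤ tower (2 * n + 2) := by
  change (2 ^ tower n) ^ (2 * tower (2 * n)) ≤ 2 ^ 2 ^ tower (2 * n)
  rw [← pow_mul]
  refine Nat.pow_le_pow_right two_pos ?_
  set a := tower (2 * n - 1) with ha
  have hT : tower (2 * n) = 2 ^ a := by
    rw [ha, show 2 * n = (2 * n - 1) + 1 by omega]
    rfl
  have ha10 : 10 ≤ a := by
    have := lt_tower (2 * n - 1)
    omega
  have h1 : tower n ≤ 2 ^ a := hT ▸ tower_mono (by omega)
  have h2 : 2 * a + 1 ≤ 2 ^ a := by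
    have := mul_le_two_pow ha10
    omega
  calc tower n * (2 * tower (2 * n)) ≤ 2 ^ a * (2 * 2 ^ a) := by
        rw [hT]
        exact Nat.mul_le_mul_right _ h1
    _ = 2 ^ (2 * a + 1) := by ring
    _ ≤ 2 ^ 2 ^ a := Nat.pow_le_pow_right two_pos h2
    _ = 2 ^ tower (2 * n) := by rw [hT]

lemma floor_logb_rpow_le {n : ℕ} (hn : 1 ≤ n) :
    ⌊Real.logb 2 ((n : ℝ) ^ ((1 : ℝ) / 5) / 40)⌋₊ ≤ n := by
  have hn' : (1 : ℝ) ≤ n := by exact_mod_cast hn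
  have hpos : 0 < (n : ℝ) ^ ((1 : ℝ) / 5) := Real.rpow_pos_of_pos (by linarith) _
  refine Nat.floor_le_of_le ?_
  rw [Real.logb_le_iff_le_rpow one_lt_two (by positivity), Real.rpow_natCast]
  have h1 : (n : ℝ) ^ ((1 : ℝ) / 5) ≤ (n : ℝ) ^ (1 : ℝ) :=
    Real.rpow_le_rpow_of_exponent_le hn' (by norm_num)
  rw [Real.rpow_one] at h1
  have h2 : (n : ℝ) ≤ 2 ^ n := by exact_mod_cast (Nat.lt_two_pow_self (n := n)).le
  linarith

lemma accumulated_error_le {n : ℕ} (hn : 10 ≤ n) {ε β δ : ℝ} (hε : Real.exp ε ≤ 2)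
    (hβ : β ≤ 1 / 8) (hδ : δ ≤ 1 / (200 * (n : ℝ) ^ 2)) :
    β + (n - 1 : ℕ) * (Real.exp ε / (2 ^ n : ℕ) + max δ 0) ≤ 1 / 4 := by
  have hn' : (10 : ℝ) ≤ n := by exact_mod_cast hn
  have h1 : ((n - 1 : ℕ) : ℝ) ≤ n := by exact_mod_cast Nat.sub_le n 1
  have h2 : 32 * (n : ℝ) ≤ (2 ^ n : ℕ) := by exact_mod_cast mul_le_two_pow hn
  have h3 : Real.exp ε / (2 ^ n : ℕ) ≤ 2 / (32 * n) := by gcongr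
  have h4 : max δ 0 ≤ 1 / (200 * (n : ℝ) ^ 2) := max_le hδ (by positivity)
  have h5 : 1 / (200 * (n : ℝ) ^ 2) ≤ 1 / (200 * n) := by
    gcongr
    nlinarith
  have h6 : ((n - 1 : ℕ) : ℝ) * (Real.exp ε / (2 ^ n : ℕ) + max δ 0) ≤
      n * (2 / (32 * n) + 1 / (200 * n)) := by
    gcongr
    exact h4.trans h5
  have h7 : (n : ℝ) * (2 / (32 * n) + 1 / (200 * n)) = 27 / 400 := by
    field_simp
    norm_num
  linarith

theorem one_cluster_lower_bound :
    ∃ c : ℝ, 0 < c ∧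
      ∀ (ε β δ : ℝ) (n t : ℕ) (Δ : ℤ) (w : ℝ) (X : Set ℝ), X.Finite →
        0 < ε → ε < 1 / 8 → 0 < β → β < 1 / 8 →
        40 ^ 5 ≤ n → δ ≤ 1 / (200 * (n : ℝ) ^ 2) →
        Δ < (t : ℤ) → t ≤ n →
        1 ≤ w → w ≤ (1 / 4) * (tower ⌊Real.logb 2 ((n : ℝ) ^ ((1 : ℝ) / 5) / 40)⌋₊ : ℝ) →
        (∃ M : (Fin n → ℝ) → Measure (ℝ × ℝ≥0),
          (∀ S, IsProbabilityMeasure (M S)) ∧ IsDPOn X M ε δ ∧ Solves1Cluster X M t Δ w β) →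
        c * (logStar (X.ncard : ℝ) : ℝ) ≤ (n : ℝ) := by
  refine ⟨1 / 3, by norm_num, ?_⟩
  rintro ε β δ n t Δ w X hX hε hε' - hβ hn hδ hΔ ht hw hw' ⟨M, hM, hdp, hsol⟩
  have hn10 : 10 ≤ n := le_trans (by norm_num) hn
  have hn' : (10 : ℝ) ≤ n := by exact_mod_cast hn10
  rcases lt_or_ge X.ncard (tower (2 * n + 2)) with hlt | hge
  · have h : logStar (X.ncard : ℝ) ≤ 2 * n + 2 :=
      logStar_le_of_le_tower (by exact_mod_cast hlt.le)
    have h' : (logStar (X.ncard : ℝ) : ℝ) ≤ 2 * n + 2 := by exact_mod_cast h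
    linarith
  · exfalso
    have hexp : Real.exp ε ≤ 2 := by
      have h1 := Real.exp_bound_div_one_sub_of_interval hε.le (by linarith)
      have h2 : 1 / (1 - ε) ≤ 2 := by
        rw [div_le_iff₀ (by linarith)]
        linarith
      linarith
    have hδ' : max δ 0 < 1 / 4 := by
      have : 1 / (200 * (n : ℝ) ^ 2) < 1 / 4 := by
        gcongr
        nlinarith
      exact max_lt (by linarith) (by norm_num)
    have hK : 2 * (2 * w) + 4 ≤ (tower (n + 1) : ℝ) := by
      have h1 : (tower ⌊Real.logb 2 ((n : ℝ) ^ ((1 : ℝ) / 5) / 40)⌋₊ : ℝ) ≤ tower n := by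
        exact_mod_cast tower_mono (floor_logb_rpow_le (by omega))
      have h2 : tower n + 4 ≤ tower (n + 1) := by
        have h3 := lt_tower n
        have h4 : 32 * tower n ≤ tower (n + 1) := mul_le_two_pow (by omega)
        omega
      have h2' : (tower n : ℝ) + 4 ≤ tower (n + 1) := by exact_mod_cast h2
      linarith
    obtain ⟨m, hm⟩ : ∃ m, tower (2 * n) = m + 1 :=
      Nat.exists_eq_succ_of_ne_zero (by have := lt_tower (2 * n); omega)
    have hsize : tower (n + 1) ^ (2 * (m + 1)) ≤ X.ncard := by
      rw [← hm]
      exact (tower_pow_le hn10).trans hge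
    obtain ⟨σ, hσ, y, hyX, hy⟩ := exists_lacunary_sequence (by linarith) hK hX hsize
    have hip := hasInteriorPoint_of_cluster hΔ ht (by omega) (by linarith) hε.le hσ hyX hy
      hM hdp hsol
    obtain ⟨k, rfl⟩ : ∃ k, n = k + 1 := ⟨n - 1, by omega⟩
    refine not_hasInteriorPoint (Nat.two_pow_pos (k + 1)) hexp hδ' k ?_
      (accumulated_error_le hn10 hexp hβ.le hδ) hip
    rw [← hm]
    refine le_trans ?_ ((hardSize_le_tower hn10 k).trans (tower_mono (by omega)))
    exact Nat.le_mul_of_pos_left _ (by omega)
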